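/- arXiv:1605.06892 — 11 statements merged into one kernel-verified Lean document; each statement's English description precedes it below -/
import Mathlib

section
/- Let E be a finite-dimensional real inner product space, h : E → ℝ a differentiable strictly convex function with Bregman distance D, C a closed convex subset of E, and φ a proper convex function whose domain is an open set containing C. Let z ∈ E and suppose z* = argmin_{x ∈ C} { φ(x) + D(x,z) }. Then for every x in C (in the domain of φ), φ(x) + D(x,z) ≥ φ(z*) + D(z*,z) + D(x,z*). -/
open RealInnerProductSpace

/-- Lemma 2.2: if `z*` minimizes `φ(·) + D(·,z)` over a closed convex set `C`,
where `φ` is convex on an open set containing `C` and `D` is the Bregman distance of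
a differentiable strictly convex function `h`, then for all `x ∈ C`,
`φ(x) + D(x,z) ≥ φ(z*) + D(z*,z) + D(x,z*)`. -/
theorem bregman_three_point_argmin
    {E : Type*} [NormedAddCommGroup E] [InnerProductSpace ℝ E] [FiniteDimensional ℝ E]
    (h : E → ℝ) (h' : E → E)
    (hdiff : ∀ x, HasGradientAt h (h' x) x)
    (hstrict : StrictConvexOn ℝ Set.univ h)
    (D : E → E → ℝ) (hD : ∀ x y, D x y = h x - h y - ⟪h' y, x - y⟫)
    (C : Set E) (hCclosed : IsClosed C) (hCconvex : Convex ℝ C)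
    (U : Set E) (hUopen : IsOpen U) (hCU : C ⊆ U)
    (φ : E → ℝ) (hφ : ConvexOn ℝ U φ)
    (z zstar : E) (hzstar : zstar ∈ C)
    (hmin : ∀ x ∈ C, φ zstar + D zstar z ≤ φ x + D x z) :
    ∀ x ∈ C, φ zstar + D zstar z + D x zstar ≤ φ x + D x z := by
  intro x hx
  have hline : HasDerivAt (fun t : ℝ => zstar + t • (x - zstar)) (x - zstar) 0 := by
    simpa using ((hasDerivAt_id (0 : ℝ)).smul_const (x - zstar)).const_add zstar
  have hgrad : HasFDerivAt h (InnerProductSpace.toDual ℝ E (h' zstar))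
      (zstar + (0 : ℝ) • (x - zstar)) := by
    simpa using (hdiff zstar).hasFDerivAt
  have hderiv : HasDerivAt (fun t : ℝ => h (zstar + t • (x - zstar)))
      ⟪h' zstar, x - zstar⟫ 0 := by
    simpa [Function.comp_def] using hgrad.comp_hasDerivAt (0 : ℝ) hline
  have hlower : φ zstar - φ x + ⟪h' z, x - zstar⟫ ≤ ⟪h' zstar, x - zstar⟫ := by
    refine ge_of_tendsto hderiv.tendsto_slope_zero_right ?_
    filter_upwards [Ioc_mem_nhdsGT (zero_lt_one' ℝ)] with t ht
    obtain ⟨ht0, ht1⟩ := ht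
    have hy : (1 - t) • zstar + t • x = zstar + t • (x - zstar) := by module
    have hyC : zstar + t • (x - zstar) ∈ C :=
      hy ▸ hCconvex hzstar hx (sub_nonneg.2 ht1) ht0.le (by ring)
    have hφy := hφ.2 (hCU hzstar) (hCU hx) (sub_nonneg.2 ht1) ht0.le (by ring)
    rw [hy, smul_eq_mul, smul_eq_mul] at hφy
    have hle := hmin _ hyC
    have hinner : ⟪h' z, zstar + t • (x - zstar) - z⟫
        = ⟪h' z, zstar - z⟫ + t * ⟪h' z, x - zstar⟫ := by
      rw [add_sub_right_comm, inner_add_right, real_inner_smul_right]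
    rw [hD, hD, hinner] at hle
    simp only [zero_add, zero_smul, add_zero, smul_eq_mul]
    rw [inv_mul_eq_div, le_div_iff₀ ht0]
    linarith
  have hsplit : ⟪h' z, x - z⟫ = ⟪h' z, x - zstar⟫ + ⟪h' z, zstar - z⟫ := by
    rw [← inner_add_right, sub_add_sub_cancel]
  rw [hD, hD, hD, hsplit]
  linarith
end

section
/- Let E be a finite-dimensional real inner product space and f : E → ℝ a convex differentiable function whose gradient is Lipschitz continuous with constant L > 0 (f is L-smooth). Then for all x, y in E, (1/(2L))‖∇f(y) − ∇f(x)‖² + ⟨∇f(y), x − y⟩ ≤ f(x) − f(y). -/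
open RealInnerProductSpace

theorem HasGradientAt.hasDerivAt_comp_add_smul
    {E : Type*} [NormedAddCommGroup E] [InnerProductSpace ℝ E] [CompleteSpace E]
    {f : E → ℝ} {g a v : E} {t : ℝ} (h : HasGradientAt f g (a + t • v)) :
    HasDerivAt (fun s : ℝ => f (a + s • v)) ⟪g, v⟫ t := by
  have hline : HasDerivAt (fun s : ℝ => a + s • v) v t := by
    simpa using ((hasDerivAt_id t).smul_const v).const_add a
  simpa [Function.comp_def] using h.hasFDerivAt.comp_hasDerivAt t hline

/-- The descent lemma for functions with Lipschitz gradient. -/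
theorem le_add_inner_add_of_lipschitz_gradient
    {E : Type*} [NormedAddCommGroup E] [InnerProductSpace ℝ E] [CompleteSpace E]
    {f : E → ℝ} {f' : E → E} {L : ℝ} (hdiff : ∀ x, HasGradientAt f (f' x) x)
    (hlip : ∀ x y : E, ‖f' x - f' y‖ ≤ L * ‖x - y‖) (a v : E) :
    f (a + v) ≤ f a + ⟪f' a, v⟫ + L / 2 * ‖v‖ ^ 2 := by
  let h : ℝ → ℝ := fun t => f (a + t • v) - t * ⟪f' a, v⟫ - L / 2 * ‖v‖ ^ 2 * t ^ 2
  have hd (t : ℝ) :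
      HasDerivAt h (⟪f' (a + t • v), v⟫ - ⟪f' a, v⟫ - L * ‖v‖ ^ 2 * t) t := by
    have h1 := (hdiff (a + t • v)).hasDerivAt_comp_add_smul
    have h2 := (hasDerivAt_id t).mul_const ⟪f' a, v⟫
    have h3 := (hasDerivAt_pow 2 t).const_mul (L / 2 * ‖v‖ ^ 2)
    refine ((h1.sub h2).sub h3).congr_deriv ?_
    norm_num
    ring
  have hanti : AntitoneOn h (Set.Ici 0) := by
    refine antitoneOn_of_hasDerivWithinAt_nonpos (convex_Ici 0)
      (fun t _ => (hd t).continuousAt.continuousWithinAt)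
      (fun t _ => (hd t).hasDerivWithinAt) fun t ht => ?_
    have ht : 0 < t := by simpa using ht
    have hgrad : ‖f' (a + t • v) - f' a‖ ≤ L * (t * ‖v‖) := by
      simpa [norm_smul, abs_of_pos ht] using hlip (a + t • v) a
    have hinner := real_inner_le_norm (f' (a + t • v) - f' a) v
    rw [inner_sub_left] at hinner
    nlinarith [mul_le_mul_of_nonneg_right hgrad (norm_nonneg v)]
  have h01 := hanti (Set.mem_Ici.2 le_rfl) (Set.mem_Ici.2 zero_le_one) zero_le_one
  simp only [h, one_smul, zero_smul, add_zero] at h01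
  linarith

/-- The gradient inequality for convex functions. -/
theorem ConvexOn.add_inner_gradient_le
    {E : Type*} [NormedAddCommGroup E] [InnerProductSpace ℝ E] [CompleteSpace E]
    {f : E → ℝ} {g a : E} (hconv : ConvexOn ℝ Set.univ f) (hg : HasGradientAt f g a) (v : E) :
    f a + ⟪g, v⟫ ≤ f (a + v) := by
  have hc : ConvexOn ℝ Set.univ (fun t : ℝ => f (a + t • v)) := by
    refine ⟨convex_univ, fun s _ t _ p q hp hq hpq => ?_⟩
    convert hconv.2 (Set.mem_univ (a + s • v)) (Set.mem_univ (a + t • v)) hp hq hpq using 2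
    obtain rfl := eq_sub_of_add_eq hpq
    module
  have hd : HasDerivAt (fun t : ℝ => f (a + t • v)) ⟪g, v⟫ 0 :=
    HasGradientAt.hasDerivAt_comp_add_smul (by simpa using hg)
  have hs := hc.le_slope_of_hasDerivAt (Set.mem_univ 0) (Set.mem_univ 1) zero_lt_one hd
  simp only [slope_def_field, one_smul, zero_smul, add_zero, sub_zero, div_one] at hs
  linarith

/-- Lemma 2.4(2): for a convex `L`-smooth function `f`,
`(1/(2L))‖∇f(y) - ∇f(x)‖² + ⟪∇f(y), x - y⟫ ≤ f(x) - f(y)` for all `x, y`. -/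
theorem smooth_convex_lower_bound
    {E : Type*} [NormedAddCommGroup E] [InnerProductSpace ℝ E] [FiniteDimensional ℝ E]
    (f : E → ℝ) (f' : E → E) (L : ℝ) (hL : 0 < L)
    (hconv : ConvexOn ℝ Set.univ f)
    (hdiff : ∀ x, HasGradientAt f (f' x) x)
    (hlip : ∀ x y : E, ‖f' x - f' y‖ ≤ L * ‖x - y‖) :
    ∀ x y : E, 1 / (2 * L) * ‖f' y - f' x‖ ^ 2 + ⟪f' y, x - y⟫ ≤ f x - f y := by
  intro x y
  set d := f' y - f' x with hd
  have hup := le_add_inner_add_of_lipschitz_gradient hdiff hlip x (L⁻¹ • d)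
  have hlow := hconv.add_inner_gradient_le (hdiff y) (x - y + L⁻¹ • d)
  rw [← add_assoc, add_sub_cancel, inner_add_right] at hlow
  have hdd : ⟪f' y, L⁻¹ • d⟫ - ⟪f' x, L⁻¹ • d⟫ = L⁻¹ * ‖d‖ ^ 2 := by
    rw [← inner_sub_left, ← hd, inner_smul_right, real_inner_self_eq_norm_sq]
  have hn : L / 2 * ‖L⁻¹ • d‖ ^ 2 = 1 / (2 * L) * ‖d‖ ^ 2 := by
    rw [norm_smul, Real.norm_of_nonneg (inv_nonneg.2 hL.le)]
    field_simp
  have hL2 : L⁻¹ * ‖d‖ ^ 2 = 2 * (1 / (2 * L) * ‖d‖ ^ 2) := by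
    field_simp
  linarith
end

section
/- Let E be a finite-dimensional real inner product space, n ≥ 1, f₁, ..., fₙ : E → ℝ convex differentiable functions, each Lᵢ-smooth, F = (1/n)∑ᵢ fᵢ, L_A = (1/n)∑ᵢ Lᵢ, and P : E → ℝ ∪ {+∞} a convex lower semi-continuous function. Let L_Q > 0, α₁, α₂ ≥ 0 and α₃ > 0 with α₁ + α₂ + α₃ = 1, and set L̄ = L_A + L_Q/α₃ and θ = α₂ L̄. Let h : E → ℝ be differentiable and strongly convex with constant 1, with Bregman distance D. Fix points x_{k−1}, z_{k−1}, z_k, x̃ in the domain of P, a vector v_k ∈ E, and set y = α₁ x_{k−1} + α₂ z_{k−1} + α₃ x̃ and x̂ = α₁ x_{k−1} + α₂ z_k + α₃ x̃. Suppose x_k in the domain of P satisfies ⟨v_k, x_k⟩ + (L̄/2)‖x_k − y‖² + P(x_k) ≤ ⟨v_k, x̂⟩ + (L̄/2)‖x̂ − y‖² + P(x̂). Then F(x_k) + P(x_k) ≤ F(y) + (α₃/(2 L_Q))‖∇F(y) − v_k‖² + α₂(⟨v_k, z_k − z_{k−1}⟩ + θ D(z_k, z_{k−1})) + P(x̂).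 -/
open RealInnerProductSpace

/-- The descent lemma: a function whose gradient is `L`-Lipschitz lies below its quadratic
upper model. -/
lemma descent_of_lipschitz_gradient {E : Type*} [NormedAddCommGroup E] [InnerProductSpace ℝ E]
    [CompleteSpace E] {f : E → ℝ} {f' : E → E} {L : ℝ}
    (hf : ∀ x, HasGradientAt f (f' x) x) (hL : ∀ x y, ‖f' x - f' y‖ ≤ L * ‖x - y‖) (x y : E) :
    f x ≤ f y + ⟪f' y, x - y⟫ + L / 2 * ‖x - y‖ ^ 2 := by
  have hline (t : ℝ) : HasDerivAt (fun t : ℝ => y + t • (x - y)) (x - y) t := by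
    simpa using ((hasDerivAt_id t).smul_const (x - y)).const_add y
  have hderiv (t : ℝ) : HasDerivAt
      (fun t : ℝ => f (y + t • (x - y)) - t * ⟪f' y, x - y⟫ - t ^ 2 * (L / 2 * ‖x - y‖ ^ 2))
      (⟪f' (y + t • (x - y)), x - y⟫ - ⟪f' y, x - y⟫ - 2 * t * (L / 2 * ‖x - y‖ ^ 2)) t := by
    have h₁ := (hf (y + t • (x - y))).hasFDerivAt.comp_hasDerivAt t (hline t)
    have h₂ := (hasDerivAt_id t).mul_const ⟪f' y, x - y⟫
    have h₃ := (hasDerivAt_pow 2 t).mul_const (L / 2 * ‖x - y‖ ^ 2)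
    simpa [Function.comp_def] using (h₁.fun_sub h₂).fun_sub h₃
  have hanti := antitoneOn_of_deriv_nonpos (convex_Icc (0 : ℝ) 1)
    (fun t _ => (hderiv t).continuousAt.continuousWithinAt)
    (fun t _ => (hderiv t).differentiableAt.differentiableWithinAt) (fun t ht => by
      rw [interior_Icc] at ht
      rw [(hderiv t).deriv, ← inner_sub_left]
      have h₁ := real_inner_le_norm (f' (y + t • (x - y)) - f' y) (x - y)
      have h₂ := hL (y + t • (x - y)) y
      rw [add_sub_cancel_left, norm_smul, Real.norm_of_nonneg ht.1.le] at h₂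
      have h₃ := mul_le_mul_of_nonneg_right h₂ (norm_nonneg (x - y))
      linarith)
  have h := hanti (Set.left_mem_Icc.2 zero_le_one) (Set.right_mem_Icc.2 zero_le_one) zero_le_one
  simp only [one_smul, zero_smul, add_sub_cancel, add_zero] at h
  linarith

/-- The descent lemma for an average of functions with Lipschitz gradients. -/
lemma descent_average {E ι : Type*} [NormedAddCommGroup E] [InnerProductSpace ℝ E]
    [CompleteSpace E] [Fintype ι] {c : ℝ} (hc : 0 ≤ c) {f : ι → E → ℝ} {f' : ι → E → E} {L : ι → ℝ}
    (hf : ∀ i x, HasGradientAt (f i) (f' i x) x)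
    (hL : ∀ i, ∀ x y, ‖f' i x - f' i y‖ ≤ L i * ‖x - y‖) {g y : E}
    (hg : HasGradientAt (fun u => c * ∑ i, f i u) g y) (x : E) :
    c * ∑ i, f i x ≤ c * ∑ i, f i y + ⟪g, x - y⟫ + (c * ∑ i, L i) / 2 * ‖x - y‖ ^ 2 := by
  have hinner : ⟪g, x - y⟫ = c * ∑ i, ⟪f' i y, x - y⟫ := by
    have h := (HasFDerivAt.fun_sum (u := Finset.univ)
      fun i _ => (hf i y).hasFDerivAt).const_mul c
    simpa using congrArg (fun φ => φ (x - y)) (hg.hasFDerivAt.unique h)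
  have hsum := Finset.sum_le_sum fun i (_ : i ∈ Finset.univ) =>
    descent_of_lipschitz_gradient (hf i) (hL i) x y
  rw [Finset.sum_add_distrib, Finset.sum_add_distrib, ← Finset.sum_mul, ← Finset.sum_div] at hsum
  rw [hinner]
  have := mul_le_mul_of_nonneg_left hsum hc
  linarith

/-- Young's inequality for the real inner product. -/
lemma real_inner_le_young {E : Type*} [NormedAddCommGroup E] [InnerProductSpace ℝ E]
    {a : ℝ} (ha : 0 < a) (u w : E) :
    ⟪u, w⟫ ≤ 1 / (2 * a) * ‖u‖ ^ 2 + a / 2 * ‖w‖ ^ 2 := by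
  have h : 1 / (2 * a) * ‖u‖ ^ 2 + a / 2 * ‖w‖ ^ 2 - ‖u‖ * ‖w‖
      = 1 / (2 * a) * (‖u‖ - a * ‖w‖) ^ 2 := by
    field_simp
    ring
  have : 0 ≤ 1 / (2 * a) * (‖u‖ - a * ‖w‖) ^ 2 := by positivity
  linarith [real_inner_le_norm u w]

/-- Lemma 3.2 (the "bridge" lemma): under the update rule (3.2) of the ASMD
algorithm, `F(x_k) + P(x_k) ≤ F(y) + (α₃/(2L_Q))‖∇F(y) − v_k‖²
+ α₂(⟪v_k, z_k − z_{k−1}⟫ + θ D(z_k, z_{k−1})) + P(x̂)`. -/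
theorem asmd_bridge_lemma
    {E : Type*} [NormedAddCommGroup E] [InnerProductSpace ℝ E] [FiniteDimensional ℝ E]
    (n : ℕ) (hn : 1 ≤ n)
    (f : Fin n → E → ℝ) (f' : Fin n → E → E) (L : Fin n → ℝ)
    (hLpos : ∀ i, 0 < L i)
    (hconv : ∀ i, ConvexOn ℝ Set.univ (f i))
    (hdiff : ∀ i x, HasGradientAt (f i) (f' i x) x)
    (hsmooth : ∀ i, ∀ x y : E, ‖f' i x - f' i y‖ ≤ L i * ‖x - y‖)
    (F' : E → E)
    (hF : ∀ x, HasGradientAt (fun u => (1 / (n : ℝ)) * ∑ i, f i u) (F' x) x)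
    (LA : ℝ) (hLA : LA = (1 / (n : ℝ)) * ∑ i, L i)
    -- `P : E → ℝ ∪ {+∞}` is convex and lower semi-continuous
    (P : E → EReal)
    (hPconv : ∀ x y : E, ∀ a b : ℝ, 0 ≤ a → 0 ≤ b → a + b = 1 →
      P (a • x + b • y) ≤ (a : EReal) * P x + (b : EReal) * P y)
    (hPlsc : LowerSemicontinuous P)
    (hPnebot : ∀ x, P x ≠ ⊥)
    (LQ α₁ α₂ α₃ : ℝ) (hLQ : 0 < LQ)
    (hα₁ : 0 ≤ α₁) (hα₂ : 0 ≤ α₂) (hα₃ : 0 < α₃)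
    (hαsum : α₁ + α₂ + α₃ = 1)
    (Lbar θ : ℝ) (hLbar : Lbar = LA + LQ / α₃) (hθ : θ = α₂ * Lbar)
    -- `h` is differentiable and strongly convex with constant 1, D its Bregman distance
    (h : E → ℝ) (h' : E → E)
    (hhdiff : ∀ x, HasGradientAt h (h' x) x)
    (hhstrong : ∀ x y : E, h x + ⟪h' x, y - x⟫ + 1 / 2 * ‖x - y‖ ^ 2 ≤ h y)
    (D : E → E → ℝ) (hD : ∀ x y, D x y = h x - h y - ⟪h' y, x - y⟫)
    -- the points and the update rule
    (xkm zkm zk xt : E)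
    (hxkm : P xkm ≠ ⊤) (hzkm : P zkm ≠ ⊤) (hzk : P zk ≠ ⊤) (hxt : P xt ≠ ⊤)
    (v : E) (y xhat : E)
    (hy : y = α₁ • xkm + α₂ • zkm + α₃ • xt)
    (hxhat : xhat = α₁ • xkm + α₂ • zk + α₃ • xt)
    (xk : E) (hxk : P xk ≠ ⊤)
    (hupdate : ((⟪v, xk⟫ + Lbar / 2 * ‖xk - y‖ ^ 2 : ℝ) : EReal) + P xk ≤
      ((⟪v, xhat⟫ + Lbar / 2 * ‖xhat - y‖ ^ 2 : ℝ) : EReal) + P xhat) :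
    (((1 / (n : ℝ)) * ∑ i, f i xk : ℝ) : EReal) + P xk ≤
      (((1 / (n : ℝ)) * ∑ i, f i y + α₃ / (2 * LQ) * ‖F' y - v‖ ^ 2
        + α₂ * (⟪v, zk - zkm⟫ + θ * D zk zkm) : ℝ) : EReal) + P xhat := by
  by_cases hPhat : P xhat = ⊤
  · rw [hPhat, EReal.coe_add_top]
    exact le_top
  lift P xk to ℝ using ⟨hxk, hPnebot xk⟩ with p
  lift P xhat to ℝ using ⟨hPhat, hPnebot xhat⟩ with q
  norm_cast at hupdate ⊢
  have hdescent := descent_average (c := 1 / (n : ℝ)) (by positivity) hdiff hsmooth (hF y) xk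
  rw [← hLA] at hdescent
  have hyoung := real_inner_le_young (div_pos hLQ hα₃) (F' y - v) (xk - y)
  have hcoef : 1 / (2 * (LQ / α₃)) = α₃ / (2 * LQ) := by field_simp
  rw [hcoef, inner_sub_left] at hyoung
  have hLbar_nonneg : 0 ≤ Lbar := by
    have : 0 ≤ ∑ i, L i := Finset.sum_nonneg fun i _ => (hLpos i).le
    rw [hLbar, hLA]
    positivity
  have hstep : xhat - y = α₂ • (zk - zkm) := by
    rw [hy, hxhat]
    module
  have hinner : ⟪v, xhat⟫ = ⟪v, y⟫ + α₂ * ⟪v, zk - zkm⟫ := by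
    rw [← real_inner_smul_right, ← hstep, ← inner_add_right, add_sub_cancel]
  have hnorm : ‖xhat - y‖ ^ 2 = α₂ ^ 2 * ‖zk - zkm‖ ^ 2 := by
    rw [hstep, norm_smul, mul_pow, Real.norm_eq_abs, sq_abs]
  have hbregman : 1 / 2 * ‖zk - zkm‖ ^ 2 ≤ D zk zkm := by
    rw [hD, norm_sub_rev]
    linarith [hhstrong zkm zk]
  have hprox := mul_le_mul_of_nonneg_left hbregman (mul_nonneg hLbar_nonneg (sq_nonneg α₂))
  rw [hinner, hnorm] at hupdate
  rw [inner_sub_right v xk y] at hyoung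
  rw [hLbar] at hupdate hprox
  rw [hθ, hLbar]
  linarith
end

section
/- Let E be a finite-dimensional real inner product space, h : E → ℝ a differentiable strictly convex function with Bregman distance D, P a proper convex lower semi-continuous function, X a nonempty closed convex subset of E with X ∩ dom(P) ≠ ∅, v ∈ E, θ > 0, ε ≥ 0, and z₋ a point. Let z̄ = argmin_{x ∈ X} { ⟨v, x⟩ + P(x) + θ D(x, z₋) } (the exact proximal point), and let z ∈ X ∩ dom(P) be an ε-approximate minimizer, i.e. ⟨v, z⟩ + P(z) + θ D(z, z₋) ≤ min_{x ∈ X} { ⟨v, x⟩ + P(x) + θ D(x, z₋) } + ε. Then for all x ∈ X ∩ dom(P): ⟨v, z⟩ + θ D(z, z₋) ≤ ⟨v, x⟩ + P(x) + θ(D(x, z₋) − D(x, z)) − P(z) + ε − θ( D(z, z̄) − ⟨x − z, ∇h(z̄) − ∇h(z)⟩ ). -/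
open RealInnerProductSpace

/-- A function on the line that is minimal at `0` among the points of `[0, 1]` has nonnegative
derivative at `0`. -/
theorem HasDerivAt.nonneg_of_forall_Ioo_le {φ : ℝ → ℝ} {φ' : ℝ} (hφ : HasDerivAt φ φ' 0)
    (hmin : ∀ t ∈ Set.Ioo (0 : ℝ) 1, φ 0 ≤ φ t) : 0 ≤ φ' := by
  have hslope := (hasDerivAt_iff_tendsto_slope.1 hφ).mono_left
    (nhdsWithin_mono (0 : ℝ) (s := Set.Ioi 0) fun t ht => ne_of_gt ht)
  refine ge_of_tendsto hslope ?_
  filter_upwards [Ioo_mem_nhdsGT (zero_lt_one' ℝ)] with t ht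
  rw [slope_def_field]
  exact div_nonneg (sub_nonneg.2 (hmin t ht)) (by linarith [ht.1])

/-- First-order optimality: if `zbar` minimizes `g + P` over the convex set `X`, where `P` is convex
and `g` has gradient `g'` at `zbar`, then `⟪g', x - zbar⟫ + P x - P zbar ≥ 0` on `X ∩ dom P`. -/
theorem HasGradientAt.inner_add_sub_nonneg_of_isMinOn_add
    {E : Type*} [NormedAddCommGroup E] [InnerProductSpace ℝ E] [CompleteSpace E]
    {g : E → ℝ} {g' : E} {P : E → EReal}
    (hPconv : ∀ x y : E, ∀ a b : ℝ, 0 ≤ a → 0 ≤ b → a + b = 1 →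
      P (a • x + b • y) ≤ (a : EReal) * P x + (b : EReal) * P y)
    {X : Set E} (hX : Convex ℝ X) {zbar x : E} (hg : HasGradientAt g g' zbar)
    (hzbar : zbar ∈ X) (hx : x ∈ X) {p q : ℝ} (hp : P zbar = p) (hq : P x = q)
    (hmin : ∀ y ∈ X, (g zbar : EReal) + P zbar ≤ (g y : EReal) + P y) :
    0 ≤ ⟪g', x - zbar⟫ + (q - p) := by
  have hline : HasDerivAt (fun t : ℝ => zbar + t • (x - zbar)) (x - zbar) 0 := by
    simpa using ((hasDerivAt_id (0 : ℝ)).smul_const (x - zbar)).const_add zbar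
  have hcomp : HasDerivAt (fun t : ℝ => g (zbar + t • (x - zbar))) ⟪g', x - zbar⟫ 0 := by
    have hg0 : HasFDerivAt g (InnerProductSpace.toDual ℝ E g')
        (zbar + (0 : ℝ) • (x - zbar)) := by
      simpa using hg.hasFDerivAt
    exact hg0.comp_hasDerivAt (0 : ℝ) hline
  have hφ := hcomp.add ((hasDerivAt_id (0 : ℝ)).mul_const (q - p))
  rw [one_mul] at hφ
  refine hφ.nonneg_of_forall_Ioo_le fun t ht => ?_
  have hy : zbar + t • (x - zbar) = (1 - t) • zbar + t • x := by module
  have hyX : zbar + t • (x - zbar) ∈ X := by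
    rw [hy]
    exact hX hzbar hx (by linarith [ht.2]) ht.1.le (by ring)
  have hP := hPconv zbar x (1 - t) t (by linarith [ht.2]) ht.1.le (by ring)
  rw [← hy, hp, hq] at hP
  have hle := (hmin _ hyX).trans (add_le_add le_rfl hP)
  rw [hp] at hle
  have hreal : g zbar + p ≤ g (zbar + t • (x - zbar)) + ((1 - t) * p + t * q) := by
    exact_mod_cast hle
  simp only [Pi.add_apply, zero_smul, add_zero, id, zero_mul]
  linarith

/-- Lemma 3.3: if `z̄` is the exact minimizer of `⟪v, ·⟫ + P(·) + θ D(·, z₋)` over `X`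
and `z ∈ X ∩ dom P` is an `ε`-approximate minimizer, then for all `x ∈ X ∩ dom P`,
`⟪v, z⟫ + θ D(z, z₋) ≤ ⟪v, x⟫ + P(x) + θ(D(x, z₋) − D(x, z)) − P(z) + ε
  − θ(D(z, z̄) − ⟪x − z, ∇h(z̄) − ∇h(z)⟫)`. -/
theorem inexact_prox_estimate
    {E : Type*} [NormedAddCommGroup E] [InnerProductSpace ℝ E] [FiniteDimensional ℝ E]
    (h : E → ℝ) (h' : E → E)
    (hdiff : ∀ x, HasGradientAt h (h' x) x)
    (hstrict : StrictConvexOn ℝ Set.univ h)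
    (D : E → E → ℝ) (hD : ∀ x y, D x y = h x - h y - ⟪h' y, x - y⟫)
    -- `P` is a proper convex lower semi-continuous function
    (P : E → EReal)
    (hPconv : ∀ x y : E, ∀ a b : ℝ, 0 ≤ a → 0 ≤ b → a + b = 1 →
      P (a • x + b • y) ≤ (a : EReal) * P x + (b : EReal) * P y)
    (hPlsc : LowerSemicontinuous P)
    (hPnebot : ∀ x, P x ≠ ⊥) (hPproper : ∃ x, P x ≠ ⊤)
    (X : Set E) (hXne : X.Nonempty) (hXclosed : IsClosed X) (hXconvex : Convex ℝ X)
    (hXdom : ∃ x ∈ X, P x ≠ ⊤)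
    (v : E) (θ ε : ℝ) (hθ : 0 < θ) (hε : 0 ≤ ε) (zm : E)
    -- the exact proximal point
    (zbar : E) (hzbarX : zbar ∈ X)
    (hzbarmin : ∀ x ∈ X,
      ((⟪v, zbar⟫ + θ * D zbar zm : ℝ) : EReal) + P zbar ≤
        ((⟪v, x⟫ + θ * D x zm : ℝ) : EReal) + P x)
    -- the ε-approximate proximal point
    (z : E) (hzX : z ∈ X) (hzdom : P z ≠ ⊤)
    (happrox : ((⟪v, z⟫ + θ * D z zm : ℝ) : EReal) + P z ≤
      (((⟪v, zbar⟫ + θ * D zbar zm : ℝ) : EReal) + P zbar) + (ε : EReal)) :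
    ∀ x ∈ X, P x ≠ ⊤ →
      ((⟪v, z⟫ + θ * D z zm : ℝ) : EReal) ≤
        ((⟪v, x⟫ : ℝ) : EReal) + P x + ((θ * (D x zm - D x z) : ℝ) : EReal) - P z
          + (ε : EReal)
          - ((θ * (D z zbar - ⟪x - z, h' zbar - h' z⟫) : ℝ) : EReal) := by
  have hP_coe : ∀ y, P y ≠ ⊤ → ∃ r : ℝ, P y = r := fun y hy =>
    ⟨(P y).toReal, (EReal.coe_toReal hy (hPnebot y)).symm⟩
  intro x hx hxdom
  obtain ⟨px, hpx⟩ := hP_coe x hxdom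
  obtain ⟨pz, hpz⟩ := hP_coe z hzdom
  have hzbardom : P zbar ≠ ⊤ := by
    intro htop
    have hle := hzbarmin x hx
    rw [htop, hpx, EReal.coe_add_top, ← EReal.coe_add] at hle
    exact EReal.coe_ne_top _ (top_le_iff.1 hle)
  obtain ⟨p, hp⟩ := hP_coe zbar hzbardom
  have hgrad : HasGradientAt (fun y => ⟪v, y⟫ + θ * D y zm)
      (v + θ • (h' zbar - h' zm)) zbar := by
    rw [hasGradientAt_iff_hasFDerivAt]
    have hD' : HasFDerivAt (fun y => h y - h zm - ⟪h' zm, y - zm⟫)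
        (InnerProductSpace.toDual ℝ E (h' zbar) - innerSL ℝ (h' zm)) zbar :=
      ((hdiff zbar).hasFDerivAt.sub_const (h zm)).sub
        ((innerSL ℝ (h' zm)).hasFDerivAt.comp zbar ((hasFDerivAt_id zbar).sub_const zm))
    simp only [hD]
    refine ((innerSL ℝ v).hasFDerivAt.add (hD'.const_mul θ)).congr_fderiv ?_
    ext y
    simp
  have hopt := hgrad.inner_add_sub_nonneg_of_isMinOn_add hPconv hXconvex hzbarX hx hp hpx hzbarmin
  rw [hpz, hp] at happrox
  have happrox' : ⟪v, z⟫ + θ * D z zm + pz ≤ ⟪v, zbar⟫ + θ * D zbar zm + p + ε := by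
    exact_mod_cast happrox
  rw [hpx, hpz]
  suffices ⟪v, z⟫ + θ * D z zm ≤ ⟪v, x⟫ + px + θ * (D x zm - D x z) - pz + ε
      - θ * (D z zbar - ⟪x - z, h' zbar - h' z⟫) by
    exact_mod_cast this
  rw [real_inner_comm (h' zbar - h' z)]
  simp only [hD, inner_add_left, inner_sub_left, inner_sub_right, real_inner_smul_left]
    at hopt happrox' ⊢
  linarith
end

section
/- Let E be a finite-dimensional real inner product space, h : E → ℝ a differentiable strictly convex function with Bregman distance D, P a proper convex lower semi-continuous function, X a nonempty closed convex subset of E with X ∩ dom(P) ≠ ∅, v ∈ E, θ > 0, ε ≥ 0, and z₋ a point. Let z̄ = argmin_{x ∈ X} { ⟨v, x⟩ + P(x) + θ D(x, z₋) } and let z ∈ X ∩ dom(P) satisfy ⟨v, z⟩ + P(z) + θ D(z, z₋) ≤ min_{x ∈ X} { ⟨v, x⟩ + P(x) + θ D(x, z₋) } + ε. Then D(z, z̄) ≤ ε/θ. -/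
open RealInnerProductSpace

open Filter Topology in
/-- First-order necessary condition for a one-sided minimum along a segment, with a linear
perturbation. -/
theorem HasGradientAt.inner_sub_add_nonneg_of_le
    {E : Type*} [NormedAddCommGroup E] [InnerProductSpace ℝ E] [CompleteSpace E]
    {f : E → ℝ} {g x y : E} {c : ℝ} (hf : HasGradientAt f g x)
    (hle : ∀ t : ℝ, 0 < t → t ≤ 1 → f x ≤ f (x + t • (y - x)) + t * c) :
    0 ≤ ⟪g, y - x⟫ + c := by
  have hline : HasDerivAt (fun t : ℝ => x + t • (y - x)) (y - x) 0 := by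
    simpa using ((hasDerivAt_id (0 : ℝ)).smul_const (y - x)).const_add x
  have hfx : HasFDerivAt f (InnerProductSpace.toDual ℝ E g) (x + (0 : ℝ) • (y - x)) := by
    simpa using hf.hasFDerivAt
  have hderiv : HasDerivAt (fun t : ℝ => f (x + t • (y - x))) ⟪g, y - x⟫ 0 := by
    simpa [Function.comp_def] using hfx.comp_hasDerivAt (0 : ℝ) hline
  have hlim := hderiv.tendsto_slope_zero_right.add_const c
  refine ge_of_tendsto hlim ?_
  filter_upwards [Ioc_mem_nhdsGT (zero_lt_one' ℝ)] with t ht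
  have hmul : t⁻¹ * (f (x + t • (y - x)) - f x) + c
      = t⁻¹ * (f (x + t • (y - x)) + t * c - f x) := by
    field_simp [ht.1.ne']
    ring
  simp only [zero_add, zero_smul, add_zero, smul_eq_mul]
  rw [hmul]
  exact mul_nonneg (inv_nonneg.2 ht.1.le) (sub_nonneg.2 (hle t ht.1 ht.2))

/-- The estimate `D(z, z̄) ≤ ε/θ` (from inequality (3.4) in the paper) for an
`ε`-approximate proximal point `z` and the exact proximal point `z̄`. -/
theorem inexact_prox_bregman_bound
    {E : Type*} [NormedAddCommGroup E] [InnerProductSpace ℝ E] [FiniteDimensional ℝ E]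
    (h : E → ℝ) (h' : E → E)
    (hdiff : ∀ x, HasGradientAt h (h' x) x)
    (hstrict : StrictConvexOn ℝ Set.univ h)
    (D : E → E → ℝ) (hD : ∀ x y, D x y = h x - h y - ⟪h' y, x - y⟫)
    -- `P` is a proper convex lower semi-continuous function
    (P : E → EReal)
    (hPconv : ∀ x y : E, ∀ a b : ℝ, 0 ≤ a → 0 ≤ b → a + b = 1 →
      P (a • x + b • y) ≤ (a : EReal) * P x + (b : EReal) * P y)
    (hPlsc : LowerSemicontinuous P)
    (hPnebot : ∀ x, P x ≠ ⊥) (hPproper : ∃ x, P x ≠ ⊤)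
    (X : Set E) (hXne : X.Nonempty) (hXclosed : IsClosed X) (hXconvex : Convex ℝ X)
    (hXdom : ∃ x ∈ X, P x ≠ ⊤)
    (v : E) (θ ε : ℝ) (hθ : 0 < θ) (hε : 0 ≤ ε) (zm : E)
    -- the exact proximal point
    (zbar : E) (hzbarX : zbar ∈ X)
    (hzbarmin : ∀ x ∈ X,
      ((⟪v, zbar⟫ + θ * D zbar zm : ℝ) : EReal) + P zbar ≤
        ((⟪v, x⟫ + θ * D x zm : ℝ) : EReal) + P x)
    -- the ε-approximate proximal point
    (z : E) (hzX : z ∈ X) (hzdom : P z ≠ ⊤)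
    (happrox : ((⟪v, z⟫ + θ * D z zm : ℝ) : EReal) + P z ≤
      (((⟪v, zbar⟫ + θ * D zbar zm : ℝ) : EReal) + P zbar) + (ε : EReal)) :
    D z zbar ≤ ε / θ := by
  have hzbardom : P zbar ≠ ⊤ := by
    intro htop
    have hz := hzbarmin z hzX
    lift P z to ℝ using ⟨hzdom, hPnebot z⟩ with p
    rw [htop, EReal.coe_add_top, ← EReal.coe_add] at hz
    exact EReal.coe_ne_top _ (top_le_iff.1 hz)
  obtain ⟨p, hp⟩ : ∃ p : ℝ, P z = p := ⟨_, (EReal.coe_toReal hzdom (hPnebot z)).symm⟩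
  obtain ⟨q, hq⟩ : ∃ q : ℝ, P zbar = q := ⟨_, (EReal.coe_toReal hzbardom (hPnebot zbar)).symm⟩
  have hopt : 0 ≤ ⟪h' zbar, z - zbar⟫ +
      (⟪v, z - zbar⟫ - θ * ⟪h' zm, z - zbar⟫ + (p - q)) / θ := by
    refine (hdiff zbar).inner_sub_add_nonneg_of_le fun t ht0 ht1 => ?_
    have hcomb : (1 - t) • zbar + t • z = zbar + t • (z - zbar) := by module
    have hmem : zbar + t • (z - zbar) ∈ X :=
      hcomb ▸ hXconvex hzbarX hzX (sub_nonneg.2 ht1) ht0.le (by ring)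
    have hPle := hPconv zbar z (1 - t) t (sub_nonneg.2 ht1) ht0.le (by ring)
    rw [hcomb, hp, hq] at hPle
    have hmin := (hzbarmin _ hmem).trans (add_le_add_right hPle _)
    rw [hq] at hmin
    norm_cast at hmin
    rw [hD, hD, add_sub_right_comm zbar, inner_add_right (h' zm), inner_add_right v,
      real_inner_smul_right, real_inner_smul_right] at hmin
    refine le_of_mul_le_mul_left ?_ hθ
    have hscale (a : ℝ) : θ * (t * (a / θ)) = t * a := by field_simp
    rw [mul_add, hscale]
    linarith
  rw [hp, hq] at happrox
  norm_cast at happrox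
  have hopt' := mul_nonneg hθ.le hopt
  rw [mul_add, mul_div_cancel₀ _ hθ.ne'] at hopt'
  rw [le_div_iff₀ hθ]
  simp only [hD, inner_sub_right] at happrox hopt' ⊢
  linarith
end

section
/- (Deterministic sequence form of Proposition 3.2.) Let m ≥ 1 be an integer, α₃ ∈ (0,1), L̄ > 0, and let (α_{1,s})_{s≥1}, (α_{2,s})_{s≥1} be nonnegative sequences with α_{2,s} > 0 satisfying, for all s ≥ 1: (1 − α_{1,s})/α_{2,s}² ≥ α₃/α_{2,s+1}², 1/α_{2,s}² ≥ (1 − α_{2,s+1})/α_{2,s+1}², and α_{1,s} + α_{2,s} + α₃ = 1. Let nonnegative reals d_{k,s} (0 ≤ k ≤ m, s ≥ 0), D_{k,s} ≥ 0 (0 ≤ k ≤ m, s ≥ 0), reals r_{k,s} (1 ≤ k ≤ m, s ≥ 1), and nonnegative reals d̃_s (s ≥ 0) satisfy: d_{0,s} = d_{m,s−1} and D_{0,s} = D_{m,s−1} for all s ≥ 1; m·d̃_s ≤ ∑_{k=1}^m d_{k,s} for all s ≥ 0; and for all s ≥ 1, 1 ≤ k ≤ m, d_{k,s} ≤ α_{1,s}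 d_{k−1,s} + α₃ d̃_{s−1} + α_{2,s}² L̄ (D_{k−1,s} − D_{k,s}) + r_{k,s}. Then for all s ≥ 1: d̃_s ≤ α_{2,s+1}² [ (1 − α_{2,1}) d_{m,0} / (α_{2,1}² α₃ m) + (1/(m α_{2,1}²)) ∑_{k=1}^{m−1} d_{k,0} + (L̄/(m α₃)) (D_{m,0} − D_{m,s}) ] + α_{2,s+1}² ∑_{i=1}^s ∑_{k=1}^m r_{k,i}/(m α₃ α_{2,i}²). -/
theorem sum_Icc_one_pred_eq (f : ℕ → ℝ) (n : ℕ) :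
    ∑ k ∈ Finset.Icc 1 (n + 1), f (k - 1) = f 0 + ∑ k ∈ Finset.Icc 1 n, f k := by
  induction n with
  | zero => simp
  | succ n ih =>
    rw [Finset.sum_Icc_succ_top (by omega), ih, Finset.sum_Icc_succ_top (by omega)]
    simp [add_assoc]

theorem sum_Icc_one_sub_pred (f : ℕ → ℝ) (n : ℕ) :
    ∑ k ∈ Finset.Icc 1 n, (f (k - 1) - f k) = f 0 - f n := by
  induction n with
  | zero => simp
  | succ n ih =>
    rw [Finset.sum_Icc_succ_top (by omega), ih]
    simp

/-- Summing the one-step recursion over a stage bounds the weighted gap of that stage. -/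
theorem stage_sum_le {n : ℕ} {a b c L t : ℝ} {d D r : ℕ → ℝ}
    (hrec : ∀ k : ℕ, 1 ≤ k → k ≤ n + 1 →
      d k ≤ a * d (k - 1) + c * t + b ^ 2 * L * (D (k - 1) - D k) + r k) :
    d (n + 1) + (1 - a) * ∑ k ∈ Finset.Icc 1 n, d k ≤
      a * d 0 + c * ((n + 1 : ℕ) * t) + b ^ 2 * L * (D 0 - D (n + 1))
        + ∑ k ∈ Finset.Icc 1 (n + 1), r k := by
  have h := Finset.sum_le_sum fun k (hk : k ∈ Finset.Icc 1 (n + 1)) =>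
    hrec k (Finset.mem_Icc.1 hk).1 (Finset.mem_Icc.1 hk).2
  rw [Finset.sum_add_distrib, Finset.sum_add_distrib, Finset.sum_add_distrib,
    Finset.sum_const, ← Finset.mul_sum, ← Finset.mul_sum, sum_Icc_one_pred_eq,
    sum_Icc_one_sub_pred, Nat.card_Icc, Finset.sum_Icc_succ_top (by omega) d, nsmul_eq_mul,
    Nat.add_sub_cancel] at h
  linarith


/-- Proposition 3.2 (deterministic sequence form): the central recursion estimate
of the ASMD analysis. -/
theorem asmd_recursion_estimate
    (m : ℕ) (hm : 1 ≤ m)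
    (α₃ : ℝ) (hα₃pos : 0 < α₃) (hα₃lt : α₃ < 1)
    (Lbar : ℝ) (hLbar : 0 < Lbar)
    (α₁ α₂ : ℕ → ℝ)
    (hα₁nn : ∀ s : ℕ, 1 ≤ s → 0 ≤ α₁ s)
    (hα₂pos : ∀ s : ℕ, 1 ≤ s → 0 < α₂ s)
    (hrule1 : ∀ s : ℕ, 1 ≤ s → α₃ / (α₂ (s + 1)) ^ 2 ≤ (1 - α₁ s) / (α₂ s) ^ 2)
    (hrule2 : ∀ s : ℕ, 1 ≤ s → (1 - α₂ (s + 1)) / (α₂ (s + 1)) ^ 2 ≤ 1 / (α₂ s) ^ 2)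
    (hrule3 : ∀ s : ℕ, 1 ≤ s → α₁ s + α₂ s + α₃ = 1)
    (d Dd : ℕ → ℕ → ℝ) (r : ℕ → ℕ → ℝ) (dt : ℕ → ℝ)
    (hdnn : ∀ k ≤ m, ∀ s : ℕ, 0 ≤ d k s)
    (hDnn : ∀ k ≤ m, ∀ s : ℕ, 0 ≤ Dd k s)
    (hdtnn : ∀ s : ℕ, 0 ≤ dt s)
    (hlinkd : ∀ s : ℕ, 1 ≤ s → d 0 s = d m (s - 1))
    (hlinkD : ∀ s : ℕ, 1 ≤ s → Dd 0 s = Dd m (s - 1))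
    (hstage : ∀ s : ℕ, (m : ℝ) * dt s ≤ ∑ k ∈ Finset.Icc 1 m, d k s)
    (hrec : ∀ s : ℕ, 1 ≤ s → ∀ k : ℕ, 1 ≤ k → k ≤ m →
      d k s ≤ α₁ s * d (k - 1) s + α₃ * dt (s - 1)
        + (α₂ s) ^ 2 * Lbar * (Dd (k - 1) s - Dd k s) + r k s) :
    ∀ s : ℕ, 1 ≤ s →
      dt s ≤ (α₂ (s + 1)) ^ 2 *
          ((1 - α₂ 1) * d m 0 / ((α₂ 1) ^ 2 * α₃ * m)
            + 1 / (m * (α₂ 1) ^ 2) * ∑ k ∈ Finset.Icc 1 (m - 1), d k 0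
            + Lbar / (m * α₃) * (Dd m 0 - Dd m s))
        + (α₂ (s + 1)) ^ 2 *
            ∑ i ∈ Finset.Icc 1 s, ∑ k ∈ Finset.Icc 1 m, r k i / (m * α₃ * (α₂ i) ^ 2) := by
  obtain ⟨n, rfl⟩ : ∃ n, m = n + 1 := ⟨m - 1, by omega⟩
  simp only [Nat.add_sub_cancel]
  set S : ℕ → ℝ := fun s => ∑ k ∈ Finset.Icc 1 n, d k s with hS
  have hSnn (s : ℕ) : 0 ≤ S s := Finset.sum_nonneg fun k hk =>
    hdnn k (by have := Finset.mem_Icc.1 hk; omega) s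
  have hdt (s : ℕ) : ((n + 1 : ℕ) : ℝ) * dt s ≤ S s + d (n + 1) s := by
    have h := hstage s
    rwa [Finset.sum_Icc_succ_top (by omega)] at h
  set V : ℕ → ℝ := fun s =>
    (1 - α₂ (s + 1)) / α₂ (s + 1) ^ 2 * d (n + 1) s + α₃ / α₂ (s + 1) ^ 2 * S s with hV
  have hstep (s : ℕ) : V (s + 1) ≤ V s + Lbar * (Dd (n + 1) s - Dd (n + 1) (s + 1))
      + (∑ k ∈ Finset.Icc 1 (n + 1), r k (s + 1)) / α₂ (s + 1) ^ 2 := by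
    have hs : 1 ≤ s + 1 := by omega
    have hα : 0 < α₂ (s + 1) := hα₂pos _ hs
    have hsum := stage_sum_le (d := fun k => d k (s + 1)) (D := fun k => Dd k (s + 1))
      (r := fun k => r k (s + 1)) (hrec (s + 1) hs)
    simp only [hlinkd _ hs, hlinkD _ hs, Nat.add_sub_cancel] at hsum
    have hc := mul_le_mul_of_nonneg_left (hdt s) hα₃pos.le
    have hα₁ : α₁ (s + 1) = 1 - α₂ (s + 1) - α₃ := by linarith [hrule3 _ hs]
    have hbound : d (n + 1) (s + 1) + (1 - α₁ (s + 1)) * S (s + 1) ≤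
        (1 - α₂ (s + 1)) * d (n + 1) s + α₃ * S s
          + α₂ (s + 1) ^ 2 * Lbar * (Dd (n + 1) s - Dd (n + 1) (s + 1))
          + ∑ k ∈ Finset.Icc 1 (n + 1), r k (s + 1) := by
      have : α₁ (s + 1) * d (n + 1) s = (1 - α₂ (s + 1)) * d (n + 1) s - α₃ * d (n + 1) s := by
        rw [hα₁]; ring
      linarith
    calc V (s + 1)
        ≤ 1 / α₂ (s + 1) ^ 2 * d (n + 1) (s + 1)
          + (1 - α₁ (s + 1)) / α₂ (s + 1) ^ 2 * S (s + 1) :=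
          add_le_add
            (mul_le_mul_of_nonneg_right (hrule2 _ hs) (hdnn _ le_rfl _))
            (mul_le_mul_of_nonneg_right (hrule1 _ hs) (hSnn _))
      _ = (d (n + 1) (s + 1) + (1 - α₁ (s + 1)) * S (s + 1)) / α₂ (s + 1) ^ 2 := by ring
      _ ≤ _ := div_le_div_of_nonneg_right hbound (sq_nonneg _)
      _ = _ := by
        simp only [hV]
        field_simp
  have hVle (s : ℕ) : V s ≤ V 0 + Lbar * (Dd (n + 1) 0 - Dd (n + 1) s)
      + ∑ i ∈ Finset.Icc 1 s, (∑ k ∈ Finset.Icc 1 (n + 1), r k i) / α₂ i ^ 2 := by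
    induction s with
    | zero => simp
    | succ s ih =>
      rw [Finset.sum_Icc_succ_top (by omega)]
      linarith [hstep s]
  intro s hs
  have hα : 0 < α₂ (s + 1) := hα₂pos _ (by omega)
  have hα1 : 0 < α₂ 1 := hα₂pos 1 le_rfl
  have hα₃le : α₃ ≤ 1 - α₂ (s + 1) := by
    linarith [hrule3 (s + 1) (by omega), hα₁nn (s + 1) (by omega)]
  have hlow : α₃ * (((n + 1 : ℕ) : ℝ) * dt s) / α₂ (s + 1) ^ 2 ≤ V s := by
    calc _ ≤ ((1 - α₂ (s + 1)) * d (n + 1) s + α₃ * S s) / α₂ (s + 1) ^ 2 := by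
          gcongr
          linarith [mul_le_mul_of_nonneg_left (hdt s) hα₃pos.le,
            mul_le_mul_of_nonneg_right hα₃le (hdnn _ le_rfl s)]
      _ = V s := by simp only [hV]; ring
  have hr : ∑ i ∈ Finset.Icc 1 s, ∑ k ∈ Finset.Icc 1 (n + 1),
        r k i / (((n + 1 : ℕ) : ℝ) * α₃ * α₂ i ^ 2)
      = (∑ i ∈ Finset.Icc 1 s, (∑ k ∈ Finset.Icc 1 (n + 1), r k i) / α₂ i ^ 2)
        / (((n + 1 : ℕ) : ℝ) * α₃) := by
    rw [Finset.sum_div]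
    refine Finset.sum_congr rfl fun i _ => ?_
    rw [← Finset.sum_div, div_div, mul_comm (α₂ i ^ 2)]
  rw [hr]
  calc dt s = α₂ (s + 1) ^ 2 / (((n + 1 : ℕ) : ℝ) * α₃)
        * (α₃ * (((n + 1 : ℕ) : ℝ) * dt s) / α₂ (s + 1) ^ 2) := by
        field_simp
    _ ≤ α₂ (s + 1) ^ 2 / (((n + 1 : ℕ) : ℝ) * α₃) * _ :=
        mul_le_mul_of_nonneg_left (hlow.trans (hVle s)) (by positivity)
    _ = _ := by
        simp only [hV, hS, zero_add]
        field_simp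
end

section
/- Let ν ≥ 2 be a real number and let α₃ satisfy 0 < α₃ ≤ (ν−1)/(ν+1). For s ≥ 1 define α_{1,s} = 1 − α₃ − 2/(s+ν) and α_{2,s} = 2/(s+ν). Then for all s ≥ 1: α_{1,s} ≥ 0, α_{2,s} > 0, α_{1,s} + α_{2,s} + α₃ = 1, (1 − α_{1,s})/α_{2,s}² ≥ α₃/α_{2,s+1}², and 1/α_{2,s}² ≥ (1 − α_{2,s+1})/α_{2,s+1}². -/
/-- The explicit choice `α_{1,s} = 1 − α₃ − 2/(s+ν)`, `α_{2,s} = 2/(s+ν)` with `ν ≥ 2`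
and `0 < α₃ ≤ (ν−1)/(ν+1)` satisfies the parameter update rule (3.1) of ASMD. -/
theorem asmd_parameter_choice
    (ν : ℝ) (hν : 2 ≤ ν) (α₃ : ℝ) (hα₃pos : 0 < α₃) (hα₃le : α₃ ≤ (ν - 1) / (ν + 1)) :
    ∀ s : ℕ, 1 ≤ s →
      0 ≤ 1 - α₃ - 2 / ((s : ℝ) + ν) ∧
      0 < 2 / ((s : ℝ) + ν) ∧
      (1 - α₃ - 2 / ((s : ℝ) + ν)) + 2 / ((s : ℝ) + ν) + α₃ = 1 ∧
      α₃ / (2 / (((s : ℝ) + 1) + ν)) ^ 2 ≤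
        (1 - (1 - α₃ - 2 / ((s : ℝ) + ν))) / (2 / ((s : ℝ) + ν)) ^ 2 ∧
      (1 - 2 / (((s : ℝ) + 1) + ν)) / (2 / (((s : ℝ) + 1) + ν)) ^ 2 ≤
        1 / (2 / ((s : ℝ) + ν)) ^ 2 := by
  intro s hs
  have hs' : (1 : ℝ) ≤ s := by exact_mod_cast hs
  rw [add_right_comm (s : ℝ) 1 ν]
  obtain ⟨t, ht⟩ : ∃ t : ℝ, t = s + ν := ⟨_, rfl⟩
  rw [← ht]
  have ht0 : 0 < t := by linarith
  have ht1 : 0 < t + 1 := by linarith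
  have hα : α₃ ≤ 1 - 2 / t := by
    have h : 2 / t ≤ 2 / (ν + 1) := by gcongr; linarith
    have h' : (ν - 1) / (ν + 1) = 1 - 2 / (ν + 1) := by
      have : ν + 1 ≠ 0 := by linarith
      field_simp
      ring
    linarith
  have hαt : α₃ * t ≤ t - 2 := by
    calc α₃ * t ≤ (1 - 2 / t) * t := by gcongr
      _ = t - 2 := by field_simp
  have hα1 : α₃ ≤ 1 := hα.trans (by linarith [div_pos two_pos ht0])
  refine ⟨by linarith, by positivity, by ring, ?_, ?_⟩
  · have h₁ : α₃ / (2 / (t + 1)) ^ 2 = α₃ * (t + 1) ^ 2 / 4 := by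
      field_simp
      norm_num
    have h₂ : (1 - (1 - α₃ - 2 / t)) / (2 / t) ^ 2 = (α₃ * t ^ 2 + 2 * t) / 4 := by
      field_simp
      ring
    rw [h₁, h₂]
    linarith
  · have h₁ : (1 - 2 / (t + 1)) / (2 / (t + 1)) ^ 2 = (t ^ 2 - 1) / 4 := by
      field_simp
      ring
    have h₂ : 1 / (2 / t) ^ 2 = t ^ 2 / 4 := by
      field_simp
      norm_num
    rw [h₁, h₂]
    linarith
end

section
/- For μ > 0 define f_μ : ℝ → ℝ by f_μ(x) = (1/2)(x + √(x² + 4μ²)). Then f_μ is convex, f_μ is differentiable with derivative Lipschitz continuous with constant 1/(4μ) (i.e. |f_μ′(x) − f_μ′(y)| ≤ (1/(4μ))|x − y| for all x, y), and max(x,0) ≤ f_μ(x) ≤ max(x,0) + μ for all x ∈ ℝ. -/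
theorem hasDerivAt_sqrt_sq_add {c : ℝ} (hc : 0 < c) (x : ℝ) :
    HasDerivAt (fun x : ℝ => √(x ^ 2 + c)) (x / √(x ^ 2 + c)) x := by
  have h : x ^ 2 + c ≠ 0 := by positivity
  convert ((hasDerivAt_pow 2 x).add_const c).sqrt h using 1
  field_simp
  simp [mul_comm]

theorem hasDerivAt_div_sqrt_sq_add {c : ℝ} (hc : 0 < c) (x : ℝ) :
    HasDerivAt (fun x : ℝ => x / √(x ^ 2 + c)) (c / √(x ^ 2 + c) ^ 3) x := by
  have h : 0 < √(x ^ 2 + c) := by positivity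
  refine ((hasDerivAt_id x).div (hasDerivAt_sqrt_sq_add hc x) h.ne').congr_deriv ?_
  have hs : √(x ^ 2 + c) ^ 2 = x ^ 2 + c := Real.sq_sqrt (by positivity)
  simp only [id]
  field_simp
  linarith

/-- Example 4.1: `f_μ(x) = (1/2)(x + √(x² + 4μ²))` is a convex `1/(4μ)`-smooth
smoothing function of the positive part, with `max(x,0) ≤ f_μ(x) ≤ max(x,0) + μ`. -/
theorem sqrt_smoothing_of_pos_part
    (μ : ℝ) (hμ : 0 < μ) (fμ : ℝ → ℝ)
    (hf : ∀ x : ℝ, fμ x = (x + Real.sqrt (x ^ 2 + 4 * μ ^ 2)) / 2) :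
    ConvexOn ℝ Set.univ fμ ∧
    Differentiable ℝ fμ ∧
    (∀ x y : ℝ, |deriv fμ x - deriv fμ y| ≤ 1 / (4 * μ) * |x - y|) ∧
    (∀ x : ℝ, max x 0 ≤ fμ x ∧ fμ x ≤ max x 0 + μ) := by
  obtain rfl : fμ = fun x => (x + √(x ^ 2 + 4 * μ ^ 2)) / 2 := funext hf
  have hc : 0 < 4 * μ ^ 2 := by positivity
  have hd (x : ℝ) := ((hasDerivAt_id x).add (hasDerivAt_sqrt_sq_add hc x)).div_const 2
  have hdiff : Differentiable ℝ fun x => (x + √(x ^ 2 + 4 * μ ^ 2)) / 2 :=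
    fun x => (hd x).differentiableAt
  have hderiv : deriv (fun x => (x + √(x ^ 2 + 4 * μ ^ 2)) / 2) =
      fun x => (1 + x / √(x ^ 2 + 4 * μ ^ 2)) / 2 := funext fun x => (hd x).deriv
  have hd2 (x : ℝ) := ((hasDerivAt_div_sqrt_sq_add hc x).const_add 1).div_const 2
  refine ⟨?_, hdiff, fun x y => ?_, fun x => ?_⟩
  · refine Monotone.convexOn_univ_of_deriv hdiff ?_
    rw [hderiv]
    refine monotone_of_deriv_nonneg (fun x => (hd2 x).differentiableAt) fun x => ?_
    rw [(hd2 x).deriv]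
    positivity
  · rw [hderiv]
    refine convex_univ.norm_image_sub_le_of_norm_hasDerivWithin_le
      (fun z _ => (hd2 z).hasDerivWithinAt) (fun z _ => ?_) (Set.mem_univ y) (Set.mem_univ x)
    have hs : 2 * μ ≤ √(z ^ 2 + 4 * μ ^ 2) := Real.le_sqrt_of_sq_le (by nlinarith [sq_nonneg z])
    rw [Real.norm_of_nonneg (by positivity)]
    calc 4 * μ ^ 2 / √(z ^ 2 + 4 * μ ^ 2) ^ 3 / 2 ≤ 4 * μ ^ 2 / (2 * μ) ^ 3 / 2 := by gcongr
      _ = 1 / (4 * μ) := by field_simp; norm_num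
  · have hlower : |x| ≤ √(x ^ 2 + 4 * μ ^ 2) := Real.abs_le_sqrt (by linarith)
    have hupper : √(x ^ 2 + 4 * μ ^ 2) ≤ |x| + 2 * μ :=
      Real.sqrt_le_iff.2 ⟨by positivity, by nlinarith [sq_abs x, mul_nonneg (abs_nonneg x) hμ.le]⟩
    have hmax : max x 0 = (x + |x|) / 2 := by
      rcases le_total x 0 with h | h
      · rw [max_eq_right h, abs_of_nonpos h]; ring
      · rw [max_eq_left h, abs_of_nonneg h]; ring
    rw [hmax]
    constructor <;> linarith
end

section
/- Let E and F be finite-dimensional real inner product spaces, X ⊆ E a convex set, Z ⊆ F a set, and g : E × F → ℝ a function such that for each z ∈ Z the map x ↦ g(x,z) is differentiable on X with gradient ∇₁g(x,z). Suppose there is a constant A₂ ≥ 0 such that ‖∇₁g(x, z₁) − ∇₁g(x, z₂)‖ ≤ A₂‖z₁ − z₂‖ for all x ∈ X and z₁, z₂ ∈ Z. Then for all x, y ∈ X and z₁, z₂ ∈ Z: |g(x,z₁) − g(y,z₁) − (g(x,z₂) − g(y,z₂))| ≤ A₂ ‖x − y‖ ‖z₁ − z₂‖. -/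
open RealInnerProductSpace

/-- Inequality (4.4) in the proof of Theorem 4.2: if `‖∇₁g(x,z₁) − ∇₁g(x,z₂)‖ ≤ A₂‖z₁ − z₂‖`
on `X × Z` with `X` convex, then
`|g(x,z₁) − g(y,z₁) − (g(x,z₂) − g(y,z₂))| ≤ A₂‖x − y‖‖z₁ − z₂‖`. -/
theorem mixed_difference_bound
    {E F : Type*} [NormedAddCommGroup E] [InnerProductSpace ℝ E] [FiniteDimensional ℝ E]
    [NormedAddCommGroup F] [InnerProductSpace ℝ F] [FiniteDimensional ℝ F]
    (X : Set E) (hX : Convex ℝ X) (Z : Set F)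
    (g : E → F → ℝ) (g₁ : E → F → E)
    (hdiff : ∀ z ∈ Z, ∀ x ∈ X, HasGradientAt (fun x' => g x' z) (g₁ x z) x)
    (A₂ : ℝ) (hA₂ : 0 ≤ A₂)
    (hlip : ∀ x ∈ X, ∀ z₁ ∈ Z, ∀ z₂ ∈ Z, ‖g₁ x z₁ - g₁ x z₂‖ ≤ A₂ * ‖z₁ - z₂‖) :
    ∀ x ∈ X, ∀ y ∈ X, ∀ z₁ ∈ Z, ∀ z₂ ∈ Z,
      |g x z₁ - g y z₁ - (g x z₂ - g y z₂)| ≤ A₂ * ‖x - y‖ * ‖z₁ - z₂‖ := by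
  intro x hx y hy z₁ hz₁ z₂ hz₂
  have hderiv : ∀ w ∈ X, HasFDerivWithinAt (fun x' => g x' z₁ - g x' z₂)
      (InnerProductSpace.toDual ℝ E (g₁ w z₁) - InnerProductSpace.toDual ℝ E (g₁ w z₂)) X w :=
    fun w hw => ((hdiff z₁ hz₁ w hw).hasFDerivAt.sub
      (hdiff z₂ hz₂ w hw).hasFDerivAt).hasFDerivWithinAt
  have hbound : ∀ w ∈ X, ‖InnerProductSpace.toDual ℝ E (g₁ w z₁) -
      InnerProductSpace.toDual ℝ E (g₁ w z₂)‖ ≤ A₂ * ‖z₁ - z₂‖ := by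
    intro w hw
    rw [← map_sub, LinearIsometryEquiv.norm_map]
    exact hlip w hw z₁ hz₁ z₂ hz₂
  have hmvt := hX.norm_image_sub_le_of_norm_hasFDerivWithin_le hderiv hbound hy hx
  rwa [Real.norm_eq_abs, sub_sub_sub_comm, mul_right_comm] at hmvt
end

section
/- Let E and F be finite-dimensional real inner product spaces, X ⊆ E a convex set, Z ⊆ F a compact convex set, μ > 0, and a > 0. Let g : E × F → ℝ satisfy: x ↦ g(x,z) is convex and differentiable on X for each z ∈ Z with gradient ∇₁g(x,z); z ↦ g(x,z) is concave and continuous on Z for each x ∈ X; and ‖∇₁g(x, z₁) − ∇₁g(x, z₂)‖ ≤ A₂‖z₁ − z₂‖ for all x ∈ X and z₁, z₂ ∈ Z, for a constant A₂ ≥ 0. Let R : F → ℝ be continuous and strongly convex on Z with parameter a. For x ∈ X let z*(x) be the unique maximizer over Z of z ↦ g(x,z) − μ R(z). Then for all x, y ∈ X: ‖z*(x) − z*(y)‖ ≤ (2 A₂/(μ a)) ‖x − y‖. -/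
open RealInnerProductSpace

/-- A maximizer of a strongly concave function exceeds every other value by a quadratic gap. -/
theorem StrongConcaveOn.sq_dist_le_of_isMaxOn {F : Type*} [NormedAddCommGroup F]
    [InnerProductSpace ℝ F] {Z : Set F} {m : ℝ} {f : F → ℝ} (hf : StrongConcaveOn Z m f)
    {z w : F} (hz : z ∈ Z) (hw : w ∈ Z) (hmax : IsMaxOn f Z z) :
    m / 4 * ‖z - w‖ ^ 2 ≤ f z - f w := by
  have hhalf : (0 : ℝ) ≤ 1 / 2 := by norm_num
  have hsum : (1 / 2 : ℝ) + 1 / 2 = 1 := by norm_num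
  have hmid := hf.2 hz hw hhalf hhalf hsum
  have hle := isMaxOn_iff.1 hmax _ (hf.1 hz hw hhalf hhalf hsum)
  simp only [smul_eq_mul] at hmid
  linarith

/-- Subtracting a positive multiple of a strongly convex function from a concave one gives a
strongly concave function. -/
theorem ConcaveOn.sub_mul_strongConvexOn {F : Type*} [NormedAddCommGroup F]
    [InnerProductSpace ℝ F] {Z : Set F} {a μ : ℝ} {f R : F → ℝ} (hf : ConcaveOn ℝ Z f)
    (hR : StrongConvexOn Z a R) (hμ : 0 ≤ μ) :
    StrongConcaveOn Z (μ * a) (fun z => f z - μ * R z) := by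
  refine ⟨hf.1, fun z hz w hw s t hs ht hst => ?_⟩
  have h₁ := hf.2 hz hw hs ht hst
  have h₂ := mul_le_mul_of_nonneg_left (hR.2 hz hw hs ht hst) hμ
  simp only [smul_eq_mul] at h₁ h₂ ⊢
  linarith

/-- The maximizer map is Lipschitz (from the proof of Theorem 4.2): if `z*(x)` is the
unique maximizer over the compact convex set `Z` of `z ↦ g(x,z) − μR(z)`, with `R`
strongly convex with parameter `a` on `Z` and `‖∇₁g(x,z₁) − ∇₁g(x,z₂)‖ ≤ A₂‖z₁ − z₂‖`,
then `‖z*(x) − z*(y)‖ ≤ (2A₂/(μa))‖x − y‖` for all `x, y ∈ X`. -/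
theorem maximizer_map_lipschitz
    {E F : Type*} [NormedAddCommGroup E] [InnerProductSpace ℝ E] [FiniteDimensional ℝ E]
    [NormedAddCommGroup F] [InnerProductSpace ℝ F] [FiniteDimensional ℝ F]
    (X : Set E) (hX : Convex ℝ X)
    (Z : Set F) (hZcompact : IsCompact Z) (hZconvex : Convex ℝ Z) (hZne : Z.Nonempty)
    (μ a : ℝ) (hμ : 0 < μ) (ha : 0 < a)
    (g : E → F → ℝ) (g₁ : E → F → E) (A₂ : ℝ) (hA₂ : 0 ≤ A₂)
    (hconvx : ∀ z ∈ Z, ConvexOn ℝ X (fun x => g x z))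
    (hdiff : ∀ z ∈ Z, ∀ x ∈ X, HasGradientAt (fun x' => g x' z) (g₁ x z) x)
    (hconc : ∀ x ∈ X, ConcaveOn ℝ Z (g x))
    (hcont : ∀ x ∈ X, ContinuousOn (g x) Z)
    (hlip : ∀ x ∈ X, ∀ z₁ ∈ Z, ∀ z₂ ∈ Z, ‖g₁ x z₁ - g₁ x z₂‖ ≤ A₂ * ‖z₁ - z₂‖)
    (R : F → ℝ) (hRcont : ContinuousOn R Z) (hRsc : StrongConvexOn Z a R)
    (zs : E → F) (hzsZ : ∀ x ∈ X, zs x ∈ Z)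
    (hzsmax : ∀ x ∈ X, ∀ z ∈ Z, g x z - μ * R z ≤ g x (zs x) - μ * R (zs x))
    (hzsuniq : ∀ x ∈ X, ∀ z ∈ Z,
      (∀ z' ∈ Z, g x z' - μ * R z' ≤ g x z - μ * R z) → z = zs x) :
    ∀ x ∈ X, ∀ y ∈ X, ‖zs x - zs y‖ ≤ 2 * A₂ / (μ * a) * ‖x - y‖ := by
  intro x hx y hy
  have gap : ∀ u ∈ X, ∀ w ∈ Z, μ * a / 4 * ‖zs u - w‖ ^ 2 ≤
      (g u (zs u) - μ * R (zs u)) - (g u w - μ * R w) := fun u hu w hw =>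
    ((hconc u hu).sub_mul_strongConvexOn hRsc hμ.le).sq_dist_le_of_isMaxOn (hzsZ u hu) hw
      (isMaxOn_iff.2 (hzsmax u hu))
  have hgx := gap x hx (zs y) (hzsZ y hy)
  have hgy := gap y hy (zs x) (hzsZ x hx)
  rw [norm_sub_rev (zs y)] at hgy
  have hmean := hX.norm_image_sub_le_of_norm_hasFDerivWithin_le
    (f := fun u => g u (zs x) - g u (zs y)) (C := A₂ * ‖zs x - zs y‖)
    (fun u hu => ((hdiff _ (hzsZ x hx) u hu).hasFDerivAt.sub
      (hdiff _ (hzsZ y hy) u hu).hasFDerivAt).hasFDerivWithinAt)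
    (fun u hu => by
      rw [← map_sub, LinearIsometryEquiv.norm_map]
      exact hlip u hu _ (hzsZ x hx) _ (hzsZ y hy)) hy hx
  have hupper := (le_abs_self _).trans hmean
  have hm : 0 < μ * a := mul_pos hμ ha
  rw [div_mul_eq_mul_div, le_div_iff₀ hm]
  rcases (norm_nonneg (zs x - zs y)).eq_or_lt with h0 | hpos
  · rw [← h0]
    simpa using by positivity
  · refine le_of_mul_le_mul_right ?_ hpos
    linarith
end

section
/- (Theorem 4.2.) Let E and F be finite-dimensional real inner product spaces, X ⊆ E a convex set, Z ⊆ F a compact convex set, μ > 0, and a > 0. Let g : E × F → ℝ satisfy: x ↦ g(x,z) is convex and differentiable on X for each z ∈ Z with gradient ∇₁g(x,z); z ↦ g(x,z) is concave and continuous on Z for each x ∈ X; ‖∇₁g(x₁, z) − ∇₁g(x₂, z)‖ ≤ A₁‖x₁ − x₂‖ for all x₁, x₂ ∈ X, z ∈ Z; and ‖∇₁g(x, z₁) − ∇₁g(x, z₂)‖ ≤ A₂‖z₁ − z₂‖ for all x ∈ X, z₁, z₂ ∈ Z, for constants A₁, A₂ ≥ 0. Let R : F → ℝ be continuous and strongly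 convex on Z with parameter a, and for x ∈ X let z*(x) be the unique maximizer over Z of z ↦ g(x,z) − μ R(z). Then the map x ↦ ∇₁g(x, z*(x)) is Lipschitz continuous on X with constant 2A₂²/(μ a) + A₁, i.e. for all x, y ∈ X, ‖∇₁g(x, z*(x)) − ∇₁g(y, z*(y))‖ ≤ (2A₂²/(μ a) + A₁)‖x − y‖. (Consequently the smoothed max-function ĝ_μ(x) = max_{z ∈ Z}(g(x,z) − μR(z)) is (2A₂²/(μa) + A₁)-smooth with gradient ∇ĝ_μ(x) = ∇₁g(x, z*(x)).) -/
open RealInnerProductSpace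

/-- A strongly concave function grows at least quadratically away from a maximizer. -/
theorem StrongConcaveOn.quadratic_growth {F : Type*} [NormedAddCommGroup F] [NormedSpace ℝ F]
    {s : Set F} {m : ℝ} {f : F → ℝ} {z w : F} (hf : StrongConcaveOn s m f)
    (hz : z ∈ s) (hw : w ∈ s) (hmax : ∀ v ∈ s, f v ≤ f z) :
    m / 2 * ‖z - w‖ ^ 2 ≤ f z - f w := by
  set c := m / 2 * ‖z - w‖ ^ 2 with hc
  by_contra! hlt
  have hD : 0 ≤ f z - f w := sub_nonneg.2 (hmax w hw)
  have hcpos : 0 < c := hD.trans_lt hlt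
  set t := (c - (f z - f w)) / (2 * c) with ht
  have htc : t * c = (c - (f z - f w)) / 2 := by rw [ht]; field_simp
  have ht0 : 0 < t := div_pos (by linarith) (by linarith)
  have ht1 : t < 1 := (div_lt_one (by linarith)).2 (by linarith)
  have h := hf.2 hz hw (sub_nonneg.2 ht1.le) ht0.le (by ring)
  have h' := h.trans (hmax _ (hf.1 hz hw (sub_nonneg.2 ht1.le) ht0.le (by ring)))
  simp only [smul_eq_mul] at h'
  rw [← hc] at h'
  have h₂ : 0 ≤ t * ((f z - f w) - (1 - t) * c) := by linarith
  have h₃ := nonneg_of_mul_nonneg_right h₂ ht0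
  linarith

/-- Subtracting a nonnegative multiple of a strongly convex function from a concave one gives a
strongly concave function. -/
theorem ConcaveOn.strongConcaveOn_sub_mul {F : Type*} [NormedAddCommGroup F] [NormedSpace ℝ F]
    {s : Set F} {μ a : ℝ} {f R : F → ℝ} (hf : ConcaveOn ℝ s f) (hR : StrongConvexOn s a R)
    (hμ : 0 ≤ μ) : StrongConcaveOn s (μ * a) (fun z => f z - μ * R z) := by
  refine ⟨hf.1, fun x hx y hy p q hp hq hpq => ?_⟩
  have h₁ := hf.2 hx hy hp hq hpq
  have h₂ := mul_le_mul_of_nonneg_left (hR.2 hx hy hp hq hpq) hμ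
  simp only [smul_eq_mul] at h₁ h₂ ⊢
  linarith

/-- Theorem 4.2: under the stated Lipschitz assumptions on `∇₁g`, the map
`x ↦ ∇₁g(x, z*(x))` (the gradient of the smoothed max-function
`ĝ_μ(x) = max_{z ∈ Z}(g(x,z) − μR(z))`) is Lipschitz on `X` with constant
`2A₂²/(μa) + A₁`. -/
theorem smoothed_max_gradient_lipschitz
    {E F : Type*} [NormedAddCommGroup E] [InnerProductSpace ℝ E] [FiniteDimensional ℝ E]
    [NormedAddCommGroup F] [InnerProductSpace ℝ F] [FiniteDimensional ℝ F]
    (X : Set E) (hX : Convex ℝ X)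
    (Z : Set F) (hZcompact : IsCompact Z) (hZconvex : Convex ℝ Z) (hZne : Z.Nonempty)
    (μ a : ℝ) (hμ : 0 < μ) (ha : 0 < a)
    (g : E → F → ℝ) (g₁ : E → F → E) (A₁ A₂ : ℝ) (hA₁ : 0 ≤ A₁) (hA₂ : 0 ≤ A₂)
    (hconvx : ∀ z ∈ Z, ConvexOn ℝ X (fun x => g x z))
    (hdiff : ∀ z ∈ Z, ∀ x ∈ X, HasGradientAt (fun x' => g x' z) (g₁ x z) x)
    (hconc : ∀ x ∈ X, ConcaveOn ℝ Z (g x))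
    (hcont : ∀ x ∈ X, ContinuousOn (g x) Z)
    (hlipx : ∀ z ∈ Z, ∀ x₁ ∈ X, ∀ x₂ ∈ X, ‖g₁ x₁ z - g₁ x₂ z‖ ≤ A₁ * ‖x₁ - x₂‖)
    (hlipz : ∀ x ∈ X, ∀ z₁ ∈ Z, ∀ z₂ ∈ Z, ‖g₁ x z₁ - g₁ x z₂‖ ≤ A₂ * ‖z₁ - z₂‖)
    (R : F → ℝ) (hRcont : ContinuousOn R Z) (hRsc : StrongConvexOn Z a R)
    (zs : E → F) (hzsZ : ∀ x ∈ X, zs x ∈ Z)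
    (hzsmax : ∀ x ∈ X, ∀ z ∈ Z, g x z - μ * R z ≤ g x (zs x) - μ * R (zs x))
    (hzsuniq : ∀ x ∈ X, ∀ z ∈ Z,
      (∀ z' ∈ Z, g x z' - μ * R z' ≤ g x z - μ * R z) → z = zs x) :
    ∀ x ∈ X, ∀ y ∈ X,
      ‖g₁ x (zs x) - g₁ y (zs y)‖ ≤ (2 * A₂ ^ 2 / (μ * a) + A₁) * ‖x - y‖ := by
  intro x hx y hy
  set z := zs x
  set w := zs y
  have hzZ : z ∈ Z := hzsZ x hx
  have hwZ : w ∈ Z := hzsZ y hy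
  have hgx := ((hconc x hx).strongConcaveOn_sub_mul hRsc hμ.le).quadratic_growth
    hzZ hwZ (hzsmax x hx)
  have hgy := ((hconc y hy).strongConcaveOn_sub_mul hRsc hμ.le).quadratic_growth
    hwZ hzZ (hzsmax y hy)
  rw [norm_sub_rev w z] at hgy
  have hmv : ‖(g x z - g x w) - (g y z - g y w)‖ ≤ A₂ * ‖z - w‖ * ‖x - y‖ := by
    refine hX.norm_image_sub_le_of_norm_hasFDerivWithin_le (f := fun u => g u z - g u w)
      (fun u hu => ((hdiff z hzZ u hu).hasFDerivAt.sub
        (hdiff w hwZ u hu).hasFDerivAt).hasFDerivWithinAt) (fun u hu => ?_) hy hx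
    rw [← map_sub, LinearIsometryEquiv.norm_map]
    exact hlipz u hu z hzZ w hwZ
  have hμa : 0 < μ * a := mul_pos hμ ha
  have hsq : μ * a * ‖z - w‖ ^ 2 ≤ A₂ * ‖z - w‖ * ‖x - y‖ := by
    have := (le_abs_self _).trans hmv
    linarith
  have hzw : ‖z - w‖ ≤ A₂ * ‖x - y‖ / (μ * a) := by
    rw [le_div_iff₀ hμa]
    rcases (norm_nonneg (z - w)).eq_or_lt with h0 | h0
    · rw [← h0, zero_mul]
      positivity
    · refine le_of_mul_le_mul_right ?_ h0
      linarith
  calc ‖g₁ x z - g₁ y w‖ ≤ ‖g₁ x z - g₁ x w‖ + ‖g₁ x w - g₁ y w‖ :=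
      norm_sub_le_norm_sub_add_norm_sub _ _ _
    _ ≤ A₂ * (A₂ * ‖x - y‖ / (μ * a)) + A₁ * ‖x - y‖ :=
      add_le_add ((hlipz x hx z hzZ w hwZ).trans (mul_le_mul_of_nonneg_left hzw hA₂))
        (hlipx w hwZ x hx y hy)
    _ = (A₂ ^ 2 / (μ * a) + A₁) * ‖x - y‖ := by ring
    _ ≤ (2 * A₂ ^ 2 / (μ * a) + A₁) * ‖x - y‖ := by
      gcongr
      linarith [sq_nonneg A₂]
end
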